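/- Let ω be a silting class in a triangulated category T with ω = add(ω). Then ω = _ωU ∩ U_ω and the pair (_ωU, U_ω) is a bounded co-t-structure on Δ̄_T(ω). -/

import Mathlib

open CategoryTheory CategoryTheory.Limits CategoryTheory.Pretriangulated

universe v u

variable (C : Type u) [Category.{v} C] [HasZeroObject C] [HasShift C ℤ]
  [Preadditive C] [∀ n : ℤ, (CategoryTheory.shiftFunctor C n).Additive]
  [Pretriangulated C]

namespace CotPaper

variable {C}

/-- The shift `X⟦n⟧` of a class of objects `X` by `n ∈ ℤ`, closed under isomorphism. -/
def shf (X : Set C) (n : ℤ) : Set C := {Z | ∃ A ∈ X, Nonempty (Z ≅ A⟦n⟧)}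

/-- `star X Y` consists of the objects `Z` fitting in a distinguished triangle
`A ⟶ Z ⟶ B ⟶ A⟦1⟧` with `A ∈ X` and `B ∈ Y`. -/
def star (X Y : Set C) : Set C :=
  {Z | ∃ (A B : C) (f : A ⟶ Z) (g : Z ⟶ B) (h : B ⟶ A⟦(1:ℤ)⟧),
    A ∈ X ∧ B ∈ Y ∧ Triangle.mk f g h ∈ distTriang C}

/-- `X^⊥ = {Z : Hom(X', Z) = 0 for all X' ∈ X}`. -/
def rightOrth (X : Set C) : Set C := {Z | ∀ A ∈ X, ∀ f : A ⟶ Z, f = 0}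

/-- `⊥X = {Z : Hom(Z, X') = 0 for all X' ∈ X}`. -/
def leftOrth (X : Set C) : Set C := {Z | ∀ B ∈ X, ∀ f : Z ⟶ B, f = 0}

/-- A class of objects is closed under isomorphisms. -/
def isoClosed (X : Set C) : Prop := ∀ ⦃A B : C⦄, A ∈ X → (A ≅ B) → B ∈ X

/-- A class of objects is closed under direct summands. -/
def summandClosed (X : Set C) : Prop :=
  ∀ ⦃W Z : C⦄, W ∈ X → (∃ (i : Z ⟶ W) (r : W ⟶ Z), i ≫ r = 𝟙 Z) → Z ∈ X

/-- `W` is a direct sum of `A` and `B` (i.e. carries a binary biproduct structure). -/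
def isDirectSum (W A B : C) : Prop :=
  ∃ (iA : A ⟶ W) (iB : B ⟶ W) (pA : W ⟶ A) (pB : W ⟶ B),
    iA ≫ pA = 𝟙 A ∧ iB ≫ pB = 𝟙 B ∧ iA ≫ pB = 0 ∧ iB ≫ pA = 0 ∧
      pA ≫ iA + pB ≫ iB = 𝟙 W

/-- An additive class of objects: it contains a zero object and is closed under
finite (binary) direct sums. -/
def addClosed (X : Set C) : Prop :=
  (∃ Z ∈ X, IsZero Z) ∧ ∀ ⦃A B W : C⦄, A ∈ X → B ∈ X → isDirectSum W A B → W ∈ X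

/-- `X = add X` : `X` is closed under isomorphisms, finite direct sums and direct summands. -/
def isAdd (X : Set C) : Prop := isoClosed X ∧ addClosed X ∧ summandClosed X

/-- A class is suspended if it is closed under `[1]` and under extensions. -/
def suspended (X : Set C) : Prop := shf X 1 ⊆ X ∧ star X X ⊆ X

/-- A class is cosuspended if it is closed under `[-1]` and under extensions. -/
def cosuspended (X : Set C) : Prop := shf X (-1) ⊆ X ∧ star X X ⊆ X

/-- `ε^∧_n(X)`: defined inductively, `ε^∧_0(X) = X` and `Z ∈ ε^∧_{n+1}(X)` iff there is a
distinguished triangle `Z⟦-1⟧ ⟶ W ⟶ A ⟶ Z` (equivalently `W ⟶ A ⟶ Z ⟶ W⟦1⟧`) with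
`W ∈ ε^∧_n(X)` and `A ∈ X`. -/
def epsHat (X : Set C) : ℕ → Set C
  | 0 => X
  | n + 1 =>
    {Z | ∃ (W A : C) (f : W ⟶ A) (g : A ⟶ Z) (h : Z ⟶ W⟦(1:ℤ)⟧),
      W ∈ epsHat X n ∧ A ∈ X ∧ Triangle.mk f g h ∈ distTriang C}

/-- `ε^∨_n(X)`: `ε^∨_0(X) = X` and `Z ∈ ε^∨_{n+1}(X)` iff there is a distinguished
triangle `Z ⟶ A ⟶ K ⟶ Z⟦1⟧` with `A ∈ X` and `K ∈ ε^∨_n(X)`. -/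
def epsCheck (X : Set C) : ℕ → Set C
  | 0 => X
  | n + 1 =>
    {Z | ∃ (A K : C) (f : Z ⟶ A) (g : A ⟶ K) (h : K ⟶ Z⟦(1:ℤ)⟧),
      A ∈ X ∧ K ∈ epsCheck X n ∧ Triangle.mk f g h ∈ distTriang C}

/-- `X^∧ := ∪_{n ≥ 0} ε^∧_n(X)`. -/
def hat (X : Set C) : Set C := ⋃ n : ℕ, epsHat X n

/-- `X^∨ := ∪_{n ≥ 0} ε^∨_n(X)`. -/
def check (X : Set C) : Set C := ⋃ n : ℕ, epsCheck X n

/-- `X~ := (X^∧)^∨`. -/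
def tilde (X : Set C) : Set C := check (hat X)

/-- `resdim_X(M) := min {n : M ∈ ε^∧_n(X)}`, with `min ∅ = ∞`. -/
noncomputable def resdim (X : Set C) (M : C) : ℕ∞ :=
  sInf {n : ℕ∞ | ∃ m : ℕ, n = (m : ℕ∞) ∧ M ∈ epsHat X m}

/-- `coresdim_X(M) := min {n : M ∈ ε^∨_n(X)}`, with `min ∅ = ∞`. -/
noncomputable def coresdim (X : Set C) (M : C) : ℕ∞ :=
  sInf {n : ℕ∞ | ∃ m : ℕ, n = (m : ℕ∞) ∧ M ∈ epsCheck X m}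

/-- `id_X(M) := min {n ∈ ℕ : Hom(-, M[i])|_X = 0 for all i > n}`, with `min ∅ = ∞`. -/
noncomputable def idDim (X : Set C) (M : C) : ℕ∞ :=
  sInf {n : ℕ∞ | ∃ m : ℕ, n = (m : ℕ∞) ∧
    ∀ i : ℤ, (m : ℤ) < i → ∀ A ∈ X, ∀ f : A ⟶ M⟦i⟧, f = 0}

/-- `pd_X(M) := min {n ∈ ℕ : Hom(M[-i], -)|_X = 0 for all i > n}`, with `min ∅ = ∞`. -/
noncomputable def pdDim (X : Set C) (M : C) : ℕ∞ :=
  sInf {n : ℕ∞ | ∃ m : ℕ, n = (m : ℕ∞) ∧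
    ∀ i : ℤ, (m : ℤ) < i → ∀ B ∈ X, ∀ f : M⟦(-i : ℤ)⟧ ⟶ B, f = 0}

/-- `id_X(Y) := sup {id_X(M) : M ∈ Y}`. -/
noncomputable def idDimSet (X Y : Set C) : ℕ∞ := ⨆ M ∈ Y, idDim X M

/-- `pd_X(Y) := sup {pd_X(M) : M ∈ Y}`. -/
noncomputable def pdDimSet (X Y : Set C) : ℕ∞ := ⨆ M ∈ Y, pdDim X M

/-- `ω` is `X`-injective: `id_X(W) = 0` for every `W ∈ ω`. -/
def xInjective (X ω : Set C) : Prop := ∀ W ∈ ω, idDim X W = 0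

/-- `ω` is `X`-projective: `pd_X(W) = 0` for every `W ∈ ω`. -/
def xProjective (X ω : Set C) : Prop := ∀ W ∈ ω, pdDim X W = 0

/-- `ω` is a weak-cogenerator in `X`: `ω ⊆ X ⊆ X[-1] * ω`. -/
def weakCogenerator (ω X : Set C) : Prop := ω ⊆ X ∧ X ⊆ star (shf X (-1)) ω

/-- `ω` is a weak-generator in `X`: `ω ⊆ X ⊆ ω * X[1]`. -/
def weakGenerator (ω X : Set C) : Prop := ω ⊆ X ∧ X ⊆ star ω (shf X 1)

/-- `ω` is silting: `Hom(W, W'[i]) = 0` for all `W, W' ∈ ω` and all `i > 0`. -/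
def silting (ω : Set C) : Prop :=
  ∀ W ∈ ω, ∀ W' ∈ ω, ∀ i : ℤ, 0 < i → ∀ f : W ⟶ W'⟦i⟧, f = 0

/-- A thick subcategory: a (full, additive, isomorphism-closed) triangulated subcategory
closed under direct summands. -/
structure IsThick (S : Set C) : Prop where
  zero : ∃ Z ∈ S, IsZero Z
  iso : isoClosed S
  shift : ∀ n : ℤ, shf S n ⊆ S
  ext : star S S ⊆ S
  summand : summandClosed S

/-- `Δ̄_T(X)`: the smallest thick subcategory containing `X`. -/
def thickClosure (X : Set C) : Set C := ⋂₀ {S : Set C | IsThick S ∧ X ⊆ S}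

/-- `U_ω`: the smallest suspended class containing `ω`. -/
def uPlus (ω : Set C) : Set C := ⋂₀ {S : Set C | suspended S ∧ ω ⊆ S}

/-- `_ωU`: the smallest cosuspended class containing `ω`. -/
def uMinus (ω : Set C) : Set C := ⋂₀ {S : Set C | cosuspended S ∧ ω ⊆ S}

/-- `_ωŪ`: the smallest cosuspended class containing `ω` closed under direct summands. -/
def uMinusBar (ω : Set C) : Set C :=
  ⋂₀ {S : Set C | cosuspended S ∧ summandClosed S ∧ ω ⊆ S}

/-- `(A, B)` is a co-t-structure on the triangulated subcategory `S` of `C`: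
`A` and `B` are full additive subcategories of `S` closed under isomorphisms and direct
summands, `A[-1] ⊆ A`, `B[1] ⊆ B`, `Hom(A[-1], B) = 0` and `S = A[-1] * B`. -/
structure IsCotStructure (S A B : Set C) : Prop where
  subA : A ⊆ S
  subB : B ⊆ S
  isoA : isoClosed A
  isoB : isoClosed B
  addA : addClosed A
  addB : addClosed B
  summandA : summandClosed A
  summandB : summandClosed B
  shiftA : shf A (-1) ⊆ A
  shiftB : shf B 1 ⊆ B
  orth : ∀ A' ∈ shf A (-1), ∀ B' ∈ B, ∀ f : A' ⟶ B', f = 0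
  decomp : S = star (shf A (-1)) B

/-- A relative Auslander-Buchweitz context on `C` : `X` is cosuspended and closed under
direct summands, `Y` is suspended, closed under direct summands and `Y ⊆ X^∧`, and
`ω := X ∩ Y` is an `X`-injective weak-cogenerator in `X`. -/
structure RelativeABContext (X Y : Set C) : Prop where
  cosusp : cosuspended X
  summandX : summandClosed X
  susp : suspended Y
  summandY : summandClosed Y
  sub : Y ⊆ hat X
  inj : xInjective X (X ∩ Y)
  wcog : weakCogenerator (X ∩ Y) X


set_option linter.unusedSectionVars false
set_option linter.unusedVariables false
open scoped ZeroObject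

lemma mem_shf {X : Set C} {A : C} (hA : A ∈ X) (n : ℤ) : A⟦n⟧ ∈ shf X n := ⟨A, hA, ⟨Iso.refl _⟩⟩

lemma shf_iso (X : Set C) (n : ℤ) : isoClosed (shf X n) := by
  rintro A B ⟨A', h, ⟨e⟩⟩ e'
  exact ⟨A', h, ⟨e'.symm ≪≫ e⟩⟩

lemma shf_shift {X : Set C} {Z : C} {n : ℤ} (h : Z ∈ shf X n) (a k : ℤ) (hk : n + a = k) :
    Z⟦a⟧ ∈ shf X k := by
  obtain ⟨A, hA, ⟨e⟩⟩ := h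
  exact ⟨A, hA, ⟨(shiftFunctor C a).mapIso e ≪≫ ((shiftFunctorAdd' C n a k hk).app A).symm⟩⟩

lemma mem_shf_zero {X : Set C} {A : C} (hA : A ∈ X) : A ∈ shf X 0 :=
  ⟨A, hA, ⟨((shiftFunctorZero C ℤ).app A).symm⟩⟩

lemma shf_zero {X : Set C} (hX : isoClosed X) {A : C} (hA : A ∈ shf X 0) : A ∈ X := by
  obtain ⟨B, hB, ⟨e⟩⟩ := hA
  exact hX hB (((shiftFunctorZero C ℤ).app B).symm ≪≫ e.symm)

noncomputable def unsh (a : ℤ) (P : C) : P⟦-a⟧⟦a⟧ ≅ P :=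
  (shiftFunctorCompIsoId C (-a) a (by simp)).app P

noncomputable def unsh' (a : ℤ) (P : C) : P⟦a⟧⟦-a⟧ ≅ P :=
  (shiftFunctorCompIsoId C a (-a) (by simp)).app P

lemma shf_unshift {X : Set C} {Z : C} {k : ℤ} (a n : ℤ) (h : Z⟦a⟧ ∈ shf X k) (hk : n + a = k) :
    Z ∈ shf X n :=
  shf_iso X n (shf_shift h (-a) n (by omega)) (unsh' a Z)

lemma shf_neg {X : Set C} (hX : isoClosed X) {Z : C} {n m : ℤ} (h : Z ∈ shf X n) (hm : n + m = 0) :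
    Z⟦m⟧ ∈ X := shf_zero hX (shf_shift h m 0 hm)

lemma shf_of_neg {X : Set C} {Z : C} {n m : ℤ} (h : Z⟦m⟧ ∈ X) (hm : n + m = 0) :
    Z ∈ shf X n := shf_unshift m n (mem_shf_zero h) hm

lemma shf_mono {X Y : Set C} (h : X ⊆ Y) (n : ℤ) : shf X n ⊆ shf Y n := by
  rintro A ⟨B, hB, e⟩
  exact ⟨B, h hB, e⟩

lemma shf_shf {X : Set C} {Z : C} {a b : ℤ} (c : ℤ) (hc : a + b = c) (h : Z ∈ shf (shf X a) b) :
    Z ∈ shf X c := by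
  obtain ⟨A, hA, ⟨e⟩⟩ := h
  exact shf_iso X c (shf_shift hA b c hc) e.symm

lemma tri_shift {A Z B : C} {f : A ⟶ Z} {g : Z ⟶ B} {h : B ⟶ A⟦(1:ℤ)⟧}
    (hT : Triangle.mk f g h ∈ distTriang C) (n : ℤ) :
    ∃ (f' : A⟦n⟧ ⟶ Z⟦n⟧) (g' : Z⟦n⟧ ⟶ B⟦n⟧) (h' : B⟦n⟧ ⟶ A⟦n⟧⟦(1:ℤ)⟧),
      Triangle.mk f' g' h' ∈ distTriang C :=
  ⟨_, _, _, Triangle.shift_distinguished _ hT n⟩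

lemma star_shf {X : Set C} (hX : isoClosed X) (hs : star X X ⊆ X) (n : ℤ) :
    star (shf X n) (shf X n) ⊆ shf X n := by
  rintro Z ⟨A, B, f, g, h, hA, hB, hT⟩
  obtain ⟨f', g', h', hT'⟩ := tri_shift hT (-n)
  exact shf_of_neg (m := -n)
    (hs ⟨_, _, f', g', h', shf_neg hX hA (by omega), shf_neg hX hB (by omega), hT'⟩) (by omega)

lemma hom_shift_zero {Z P : C} (a : ℤ) (H : ∀ f0 : Z ⟶ P⟦-a⟧, f0 = 0) (f : Z⟦a⟧ ⟶ P) : f = 0 := by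
  have h1 := H ((unsh' a Z).inv ≫ f⟦-a⟧')
  have h2 : f⟦-a⟧' = 0 := by
    rw [← cancel_epi (unsh' a Z).inv, h1, comp_zero]
  exact (shiftFunctor C (-a)).map_injective (by rw [h2, Functor.map_zero])

lemma hom_shift_zero' {Z P : C} (a : ℤ) (H : ∀ f0 : Z⟦-a⟧ ⟶ P, f0 = 0) (f : Z ⟶ P⟦a⟧) : f = 0 := by
  have h1 := H (f⟦-a⟧' ≫ (unsh' a P).hom)
  have h2 : f⟦-a⟧' = 0 := by
    rw [← cancel_mono (unsh' a P).hom, h1, zero_comp]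
  exact (shiftFunctor C (-a)).map_injective (by rw [h2, Functor.map_zero])

lemma isoClosed_of_star {X : Set C} (hz : ∀ Z : C, IsZero Z → Z ∈ X) (hs : star X X ⊆ X) :
    isoClosed X := by
  intro A B hA e
  obtain ⟨Z, g, h, hT⟩ := distinguished_cocone_triangle e.hom
  have hZ : IsZero Z := Triangle.isZero₃_of_isIso₁ _ hT (inferInstanceAs (IsIso e.hom))
  exact hs ⟨A, Z, _, g, h, hA, hz Z hZ, hT⟩

lemma biprod_mem {X : Set C} (hs : star X X ⊆ X) {A B : C} (hA : A ∈ X) (hB : B ∈ X) :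
    (A ⊞ B) ∈ X :=
  hs ⟨A, B, _, _, _, hA, hB, binaryBiproductTriangle_distinguished A B⟩

lemma isDirectSum_iso {W A B : C} (h : isDirectSum W A B) : Nonempty (A ⊞ B ≅ W) := by
  obtain ⟨iA, iB, pA, pB, h1, h2, h3, h4, h5⟩ := h
  refine ⟨⟨biprod.desc iA iB, biprod.lift pA pB, ?_, ?_⟩⟩
  · ext <;> simp [h1, h2, h3, h4]
  · simp [h5]

lemma isDirectSum_biprod (A B : C) : isDirectSum (A ⊞ B) A B :=
  ⟨biprod.inl, biprod.inr, biprod.fst, biprod.snd, by simp, by simp, by simp, by simp, by simp⟩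

lemma addClosed_of_star {X : Set C} (hz : ∀ Z : C, IsZero Z → Z ∈ X) (hs : star X X ⊆ X) :
    addClosed X := by
  refine ⟨⟨0, hz _ (isZero_zero C), isZero_zero C⟩, ?_⟩
  intro A B W hA hB h
  obtain ⟨e⟩ := isDirectSum_iso h
  exact isoClosed_of_star hz hs (biprod_mem hs hA hB) e

def Vn (ω : Set C) (n : ℤ) : Set C :=
  {Y | ∀ k : ℤ, n < k → ∀ P ∈ shf ω k, ∀ f : Y ⟶ P, f = 0}

lemma Vn_mono (ω : Set C) {n m : ℤ} (h : n ≤ m) : Vn ω n ⊆ Vn ω m :=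
  fun _ hY k hk => hY k (by omega)

lemma Vn_summand (ω : Set C) (n : ℤ) : summandClosed (Vn ω n) := by
  rintro W Z hW ⟨i, r, hir⟩ k hk P hP f
  have := hW k hk P hP (r ≫ f)
  rw [← Category.id_comp f, ← hir, Category.assoc, this, comp_zero]

lemma Vn_iso (ω : Set C) (n : ℤ) : isoClosed (Vn ω n) :=
  fun _ _ hA e => Vn_summand ω n hA ⟨e.inv, e.hom, by simp⟩

lemma Vn_shift {ω : Set C} {n : ℤ} {Y : C} (hY : Y ∈ Vn ω n) (a m : ℤ) (h : n + a = m) :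
    Y⟦a⟧ ∈ Vn ω m := by
  intro k hk P hP f
  exact hom_shift_zero a (hY (k - a) (by omega) _ (shf_shift hP (-a) (k - a) (by omega))) f

lemma Vn_unshift {ω : Set C} {m : ℤ} {Y : C} (a n : ℤ) (hY : Y⟦a⟧ ∈ Vn ω m) (h : n + a = m) :
    Y ∈ Vn ω n := Vn_iso ω n (Vn_shift hY (-a) n (by omega)) (unsh' a Y)

lemma Vn_ext (ω : Set C) (n : ℤ) : star (Vn ω n) (Vn ω n) ⊆ Vn ω n := by
  rintro Z ⟨A, B, f, g, h, hA, hB, hT⟩ k hk P hP u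
  obtain ⟨v, hv⟩ := Triangle.yoneda_exact₂ _ hT u (hA k hk P hP _)
  rw [hv, hB k hk P hP v]
  exact comp_zero

lemma Vn_shf {ω : Set C} {n : ℤ} {Z : C} (a m : ℤ) (h : n + a = m) (hZ : Z ∈ shf (Vn ω n) a) :
    Z ∈ Vn ω m := by
  obtain ⟨A, hA, ⟨e⟩⟩ := hZ
  exact Vn_iso ω m (Vn_shift hA a m h) e.symm

lemma omega_Vn {ω : Set C} (hs : silting ω) : ω ⊆ Vn ω 0 := by
  rintro W hW k hk P ⟨W', hW', ⟨e⟩⟩ f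
  have := hs W hW W' hW' k hk (f ≫ e.hom)
  rw [← cancel_mono e.hom, this, zero_comp]

lemma zero_omega {ω : Set C} (hadd : isAdd ω) (Z : C) (hZ : IsZero Z) : Z ∈ ω := by
  obtain ⟨h1, ⟨⟨Z0, hZ0, hz⟩, _⟩, _⟩ := hadd
  exact h1 hZ0 (hz.iso hZ)

lemma uPlus_omega (ω : Set C) : ω ⊆ uPlus ω := fun _ h S hS => hS.2 h
lemma uMinus_omega (ω : Set C) : ω ⊆ uMinus ω := fun _ h S hS => hS.2 h

lemma uPlus_min {ω S : Set C} (h : suspended S) (h' : ω ⊆ S) : uPlus ω ⊆ S :=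
  fun _ hZ => hZ S ⟨h, h'⟩
lemma uMinus_min {ω S : Set C} (h : cosuspended S) (h' : ω ⊆ S) : uMinus ω ⊆ S :=
  fun _ hZ => hZ S ⟨h, h'⟩

lemma uPlus_susp (ω : Set C) : suspended (uPlus ω) := by
  constructor
  · rintro Z ⟨A, hA, e⟩ S hS
    exact hS.1.1 ⟨A, hA S hS, e⟩
  · rintro Z ⟨A, B, f, g, h, hA, hB, hT⟩ S hS
    exact hS.1.2 ⟨A, B, f, g, h, hA S hS, hB S hS, hT⟩

lemma uMinus_susp (ω : Set C) : cosuspended (uMinus ω) := by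
  constructor
  · rintro Z ⟨A, hA, e⟩ S hS
    exact hS.1.1 ⟨A, hA S hS, e⟩
  · rintro Z ⟨A, B, f, g, h, hA, hB, hT⟩ S hS
    exact hS.1.2 ⟨A, B, f, g, h, hA S hS, hB S hS, hT⟩

lemma uPlus_iso {ω : Set C} (hadd : isAdd ω) : isoClosed (uPlus ω) :=
  isoClosed_of_star (fun Z hZ => uPlus_omega ω (zero_omega hadd Z hZ)) (uPlus_susp ω).2
lemma uMinus_iso {ω : Set C} (hadd : isAdd ω) : isoClosed (uMinus ω) :=
  isoClosed_of_star (fun Z hZ => uMinus_omega ω (zero_omega hadd Z hZ)) (uMinus_susp ω).2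

lemma uMinus_Vn {ω : Set C} (hs : silting ω) : uMinus ω ⊆ Vn ω 0 :=
  uMinus_min ⟨fun _ hZ => Vn_mono ω (by omega) (Vn_shf (-1) (-1) (by omega) hZ), Vn_ext ω 0⟩
    (omega_Vn hs)

def U2 (ω : Set C) : Set C := {X | ∀ Y ∈ Vn ω (-1), ∀ f : Y ⟶ X, f = 0}

def Good (ω : Set C) : Set C :=
  {X | X ∈ U2 ω ∧ ∃ W ∈ ω, ∃ p : W ⟶ X, ∀ Y ∈ Vn ω 0, ∀ f : Y ⟶ X, ∃ g, g ≫ p = f}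

lemma U2_shift {ω : Set C} {X Y : C} (hX : X ∈ U2 ω) (n a : ℤ) (hY : Y ∈ Vn ω n) (ha : n < a)
    (f : Y ⟶ X⟦a⟧) : f = 0 :=
  hom_shift_zero' a (hX _ (Vn_mono ω (by omega) (Vn_shift hY (-a) (n + -a) rfl))) f

lemma U2_iso (ω : Set C) : isoClosed (U2 ω) := by
  intro A B hA e Y hY f
  rw [← cancel_mono e.inv, zero_comp]
  exact hA Y hY _

lemma omega_U2 (ω : Set C) : ω ⊆ U2 ω := by
  intro W hW Y hY f
  exact hY 0 (by omega) W (mem_shf_zero hW) f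

lemma Good_susp {ω : Set C} (hs : silting ω) (hadd : isAdd ω) : suspended (Good ω) := by
  constructor
  · rintro Z ⟨A, ⟨hA, -⟩, ⟨e⟩⟩
    have key : ∀ Y ∈ Vn ω 0, ∀ f : Y ⟶ Z, f = 0 := by
      intro Y hY f
      rw [← cancel_mono e.hom, zero_comp]
      exact U2_shift hA 0 1 hY (by omega) _
    refine ⟨fun Y hY f => key Y (Vn_mono ω (by omega) hY) f, (0 : C), zero_omega hadd _ (isZero_zero C),
      (0 : (0 : C) ⟶ Z), ?_⟩
    intro Y hY f
    exact ⟨0, by rw [key Y hY f, comp_zero]⟩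
  · rintro Z ⟨A, B, a, b, c, ⟨hA, W1, hW1, p1, h1⟩, ⟨hB, W2, hW2, p2, h2⟩, hT⟩
    refine ⟨?_, ?_⟩
    · intro Y hY f
      obtain ⟨g, hg⟩ := Triangle.coyoneda_exact₂ _ hT f (hB Y hY _)
      rw [hg, hA Y hY g]
      exact zero_comp
    · obtain ⟨q, hq⟩ := Triangle.coyoneda_exact₃ _ hT p2
        (U2_shift hA 0 1 (omega_Vn hs hW2) (by omega) _)
      change W2 ⟶ Z at q
      change p2 = q ≫ b at hq
      refine ⟨W1 ⊞ W2, hadd.2.1.2 hW1 hW2 (isDirectSum_biprod _ _), biprod.desc (p1 ≫ a) q, ?_⟩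
      intro Y hY f
      obtain ⟨g, hg⟩ := h2 Y hY (f ≫ b)
      obtain ⟨k, hk⟩ := Triangle.coyoneda_exact₂ _ hT (f - g ≫ q) (by
        change (f - g ≫ q) ≫ b = 0
        rw [Preadditive.sub_comp, Category.assoc, ← hq, hg, sub_self])
      change Y ⟶ A at k
      change f - g ≫ q = k ≫ a at hk
      obtain ⟨l, hl⟩ := h1 Y hY k
      refine ⟨biprod.lift l g, ?_⟩
      rw [biprod.lift_desc, ← Category.assoc, hl, ← hk]
      abel

lemma omega_Good (ω : Set C) : ω ⊆ Good ω := fun W hW =>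
  ⟨omega_U2 ω hW, W, hW, 𝟙 W, fun _ _ f => ⟨f, Category.comp_id f⟩⟩

lemma uPlus_Good {ω : Set C} (hs : silting ω) (hadd : isAdd ω) : uPlus ω ⊆ Good ω :=
  uPlus_min (Good_susp hs hadd) (omega_Good ω)

lemma Good_summand (ω : Set C) : summandClosed (Good ω) := by
  rintro W Z ⟨hW, W0, h0, p, hp⟩ ⟨i, r, hir⟩
  refine ⟨?_, W0, h0, p ≫ r, ?_⟩
  · intro Y hY f
    rw [← Category.comp_id f, ← hir, ← Category.assoc, hW Y hY (f ≫ i), zero_comp]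
  · intro Y hY f
    obtain ⟨g, hg⟩ := hp Y hY (f ≫ i)
    exact ⟨g, by rw [← Category.assoc, hg, Category.assoc, hir, Category.comp_id]⟩

lemma Good_Vn {ω : Set C} (hadd : isAdd ω) {Z : C} (h : Z ∈ Good ω) (h' : Z ∈ Vn ω 0) : Z ∈ ω := by
  obtain ⟨-, W, hW, p, hp⟩ := h
  obtain ⟨g, hg⟩ := hp Z h' (𝟙 Z)
  exact hadd.2.2 hW ⟨g, p, hg⟩

lemma inter_eq {ω : Set C} (hs : silting ω) (hadd : isAdd ω) : ω = uMinus ω ∩ uPlus ω := by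
  apply Set.Subset.antisymm
  · exact fun W hW => ⟨uMinus_omega ω hW, uPlus_omega ω hW⟩
  · rintro Z ⟨h1, h2⟩
    exact Good_Vn hadd (uPlus_Good hs hadd h2) (uMinus_Vn hs h1)

def Apx (ω : Set C) (n : ℤ) {Z G : C} (μ : Z ⟶ G) : Prop :=
  (∀ k : ℤ, n < k → ∀ P ∈ shf ω k, ∀ g : G ⟶ P, μ ≫ g = 0 → g = 0) ∧
  (∀ k : ℤ, n ≤ k → ∀ P ∈ shf ω k, ∀ f : Z ⟶ P, ∃ g : G ⟶ P, f = μ ≫ g)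

lemma Apx_iso (ω : Set C) (n : ℤ) {Z G : C} (e : Z ≅ G) : Apx ω n e.hom := by
  refine ⟨fun k _ P _ g hg => ?_, fun k _ P _ f => ⟨e.inv ≫ f, by simp⟩⟩
  rw [← cancel_epi e.hom, hg, comp_zero]

lemma Apx_comp {ω : Set C} {n m : ℤ} (h : n ≤ m) {Z G H : C} {μ : Z ⟶ G} {ν : G ⟶ H}
    (hμ : Apx ω n μ) (hν : Apx ω m ν) : Apx ω m (μ ≫ ν) := by
  refine ⟨fun k hk P hP g hg => ?_, fun k hk P hP f => ?_⟩
  · rw [Category.assoc] at hg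
    exact hν.1 k hk P hP g (hμ.1 k (by omega) P hP _ hg)
  · obtain ⟨g, hg⟩ := hμ.2 k (by omega) P hP f
    obtain ⟨g', hg'⟩ := hν.2 k hk P hP g
    exact ⟨g', by rw [hg, hg', Category.assoc]⟩

lemma Apx_shift {ω : Set C} {n : ℤ} {Z G : C} {μ : Z ⟶ G} (hμ : Apx ω n μ) (a m : ℤ)
    (h : n + a = m) : Apx ω m (μ⟦a⟧') := by
  refine ⟨fun k hk P hP g hg => ?_, fun k hk P hP f => ?_⟩
  · obtain ⟨g0, hg0⟩ := (shiftFunctor C a).map_surjective (g ≫ (unsh a P).inv)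
    have h0 : μ ≫ g0 = 0 := by
      apply (shiftFunctor C a).map_injective
      rw [Functor.map_comp, hg0, ← Category.assoc, hg, zero_comp, Functor.map_zero]
    have := hμ.1 (k - a) (by omega) _ (shf_shift hP (-a) (k - a) (by omega)) g0 h0
    rw [this, Functor.map_zero] at hg0
    rw [← cancel_mono (unsh a P).inv, ← hg0, zero_comp]
  · obtain ⟨f0, hf0⟩ := (shiftFunctor C a).map_surjective (f ≫ (unsh a P).inv)
    obtain ⟨g, hg⟩ := hμ.2 (k - a) (by omega) _ (shf_shift hP (-a) (k - a) (by omega)) f0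
    refine ⟨g⟦a⟧' ≫ (unsh a P).hom, ?_⟩
    rw [← Category.assoc, ← Functor.map_comp, ← hg, hf0, Category.assoc, Iso.inv_hom_id,
      Category.comp_id]

lemma ext_of_rot {A Z B P : C} {f : A ⟶ Z} {g : Z ⟶ B} {h : B ⟶ A⟦(1:ℤ)⟧}
    (hT : Triangle.mk f g h ∈ distTriang C) (u : A⟦(1:ℤ)⟧ ⟶ P) (hu : h ≫ u = 0) :
    ∃ v : Z⟦(1:ℤ)⟧ ⟶ P, u = f⟦(1:ℤ)⟧' ≫ v := by
  obtain ⟨v, hv⟩ := Triangle.yoneda_exact₃ _ (rot_of_distTriang _ hT) u hu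
  change Z⟦(1:ℤ)⟧ ⟶ P at v
  change u = (-f⟦(1:ℤ)⟧') ≫ v at hv
  exact ⟨-v, by rw [hv]; simp⟩

lemma Apx_ext {ω : Set C} {n : ℤ} {A Z B G₁ G G₂ : C} {a : A ⟶ Z} {b : Z ⟶ B} {c : B ⟶ A⟦(1:ℤ)⟧}
    {a' : G₁ ⟶ G} {b' : G ⟶ G₂} {c' : G₂ ⟶ G₁⟦(1:ℤ)⟧}
    (hT : Triangle.mk a b c ∈ distTriang C) (hT' : Triangle.mk a' b' c' ∈ distTriang C)
    {α : A ⟶ G₁} {β : Z ⟶ G} {γ : B ⟶ G₂} (h1 : a ≫ β = α ≫ a') (h2 : b ≫ γ = β ≫ b')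
    (h3 : c ≫ α⟦(1:ℤ)⟧' = γ ≫ c') (hα : Apx ω n α) (hγ : Apx ω n γ) : Apx ω n β := by
  have z1 : b' ≫ c' = 0 := comp_distTriang_mor_zero₂₃ _ hT'
  have z2 : a ≫ b = 0 := comp_distTriang_mor_zero₁₂ _ hT
  have z3 : c ≫ a⟦(1:ℤ)⟧' = 0 := comp_distTriang_mor_zero₃₁ _ hT
  refine ⟨fun k hk P hP g hg => ?_, fun k hk P hP f => ?_⟩
  · have h4 : a' ≫ g = 0 := hα.1 k hk P hP _ (by
      rw [← Category.assoc, ← h1, Category.assoc, hg, comp_zero])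
    obtain ⟨g2, hg2⟩ := Triangle.yoneda_exact₂ _ hT' g h4
    change G₂ ⟶ P at g2
    change g = b' ≫ g2 at hg2
    obtain ⟨x, hx⟩ := Triangle.yoneda_exact₃ _ hT (γ ≫ g2) (by
      change b ≫ γ ≫ g2 = 0
      rw [← Category.assoc, h2, Category.assoc, ← hg2, hg])
    change A⟦(1:ℤ)⟧ ⟶ P at x
    change γ ≫ g2 = c ≫ x at hx
    obtain ⟨y, hy⟩ := (Apx_shift hα 1 (n + 1) rfl).2 k (by omega) P hP x
    have h5 : g2 - c' ≫ y = 0 := hγ.1 k hk P hP _ (by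
      rw [Preadditive.comp_sub, hx, hy, ← Category.assoc, h3, Category.assoc, sub_self])
    rw [hg2, sub_eq_zero.1 h5, ← Category.assoc, z1, zero_comp]
  · obtain ⟨f1, hf1⟩ := hα.2 k hk P hP (a ≫ f)
    have h4 : c' ≫ f1⟦(1:ℤ)⟧' = 0 :=
      hγ.1 (k + 1) (by omega) _ (shf_shift hP 1 (k + 1) rfl) _ (by
        rw [← Category.assoc, ← h3, Category.assoc, ← Functor.map_comp, ← hf1, Functor.map_comp,
          ← Category.assoc, z3, zero_comp])
    obtain ⟨v, hv⟩ := ext_of_rot hT' _ h4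
    obtain ⟨g1, rfl⟩ := (shiftFunctor C (1:ℤ)).map_surjective v
    have hg1 : f1 = a' ≫ g1 := (shiftFunctor C (1:ℤ)).map_injective (by
      rw [hv, Functor.map_comp])
    obtain ⟨f2, hf2⟩ := Triangle.yoneda_exact₂ _ hT (f - β ≫ g1) (by
      change a ≫ (f - β ≫ g1) = 0
      rw [Preadditive.comp_sub, hf1, hg1, ← Category.assoc a, h1, Category.assoc, sub_self])
    change B ⟶ P at f2
    change f - β ≫ g1 = b ≫ f2 at hf2
    obtain ⟨g2, hg2⟩ := hγ.2 k hk P hP f2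
    refine ⟨g1 + b' ≫ g2, ?_⟩
    rw [Preadditive.comp_add, ← Category.assoc β b', ← h2, Category.assoc, ← hg2, ← hf2]
    abel

lemma Apx_cocone {ω : Set C} {n : ℤ} {X Z G : C} {x : X ⟶ Z} {μ : Z ⟶ G} {h : G ⟶ X⟦(1:ℤ)⟧}
    (hT : Triangle.mk x μ h ∈ distTriang C) (hμ : Apx ω n μ) : X ∈ Vn ω (n - 1) := by
  have z1 : μ ≫ h = 0 := comp_distTriang_mor_zero₂₃ _ hT
  have z2 : x ≫ μ = 0 := comp_distTriang_mor_zero₁₂ _ hT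
  refine Vn_unshift 1 (n - 1) (m := n) ?_ (by omega)
  intro k hk P hP f
  obtain ⟨g, hg⟩ := ext_of_rot hT f (hμ.1 k hk P hP _ (by
    rw [← Category.assoc, z1, zero_comp]))
  obtain ⟨y, hy⟩ := (Apx_shift hμ 1 (n + 1) rfl).2 k (by omega) P hP g
  rw [hg, hy, ← Category.assoc, ← Functor.map_comp, z2, Functor.map_zero, zero_comp]

lemma uPlus_shf_nat {ω : Set C} (hadd : isAdd ω) (n : ℕ) : shf (uPlus ω) n ⊆ uPlus ω := by
  induction n with
  | zero => exact fun Z hZ => shf_zero (uPlus_iso hadd) (by simpa using hZ)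
  | succ n ih =>
    intro Z hZ
    refine (uPlus_susp ω).1 (shf_of_neg (m := -1) (ih (shf_shift hZ (-1) n (by push_cast; omega)))
      (by omega))

lemma uMinus_shf_nat {ω : Set C} (hadd : isAdd ω) (n : ℕ) : shf (uMinus ω) (-n) ⊆ uMinus ω := by
  induction n with
  | zero => exact fun Z hZ => shf_zero (uMinus_iso hadd) (by simpa using hZ)
  | succ n ih =>
    intro Z hZ
    refine (uMinus_susp ω).1 (shf_of_neg (m := 1) (ih (shf_shift hZ 1 (-n) (by push_cast; omega)))
      (by omega))

lemma uPlus_shf_le {ω : Set C} (hadd : isAdd ω) {a b : ℤ} (h : b ≤ a) :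
    shf (uPlus ω) a ⊆ shf (uPlus ω) b := by
  intro Z hZ
  refine shf_of_neg (m := -b) (uPlus_shf_nat hadd (a - b).toNat (shf_shift hZ _ _ ?_)) (by omega)
  omega

lemma uMinus_shf_le {ω : Set C} (hadd : isAdd ω) {a b : ℤ} (h : b ≤ a) :
    shf (uMinus ω) b ⊆ shf (uMinus ω) a := by
  intro Z hZ
  refine shf_of_neg (m := -a) (uMinus_shf_nat hadd (a - b).toNat (shf_shift hZ _ _ ?_)) (by omega)
  omega

lemma cocone_mem {ω : Set C} (hadd : isAdd ω) {X Z G : C} {x : X ⟶ Z} {μ : Z ⟶ G}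
    {h : G ⟶ X⟦(1:ℤ)⟧} (hT : Triangle.mk x μ h ∈ distTriang C) (hZ : Z ∈ uPlus ω)
    (hG : G ∈ shf (uPlus ω) 1) : X ∈ uPlus ω :=
  (uPlus_susp ω).2 ⟨G⟦(-1 : ℤ)⟧, Z, _, _, _, shf_neg (uPlus_iso hadd) hG (by omega), hZ,
    inv_rot_of_distTriang _ hT⟩

lemma cocone_omega {ω : Set C} (hs : silting ω) (hadd : isAdd ω) {X Z G : C} {x : X ⟶ Z} {μ : Z ⟶ G}
    {h : G ⟶ X⟦(1:ℤ)⟧} (hT : Triangle.mk x μ h ∈ distTriang C) (hZ : Z ∈ uPlus ω)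
    (hG : G ∈ shf (uPlus ω) 1) (hμ : Apx ω 1 μ) : X ∈ ω :=
  Good_Vn hadd (uPlus_Good hs hadd (cocone_mem hadd hT hZ hG)) (by simpa using Apx_cocone hT hμ)

def StepC (ω : Set C) : Set C :=
  {Z | Z ∈ uPlus ω ∧ ∃ G ∈ shf (uPlus ω) 1, ∃ μ : Z ⟶ G, Apx ω 1 μ}

lemma step {ω : Set C} (hs : silting ω) (hadd : isAdd ω) : uPlus ω ⊆ StepC ω := by
  refine uPlus_min ⟨?_, ?_⟩ ?_
  · rintro Z ⟨A, ⟨hA, -⟩, ⟨e⟩⟩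
    exact ⟨(uPlus_susp ω).1 ⟨A, hA, ⟨e⟩⟩, A⟦(1:ℤ)⟧, mem_shf hA 1, e.hom, Apx_iso ω 1 e⟩
  · rintro Z ⟨A, B, a, b, c, ⟨hA, G₁, hG₁, α, hα⟩, ⟨hB, G₂, hG₂, γ, hγ⟩, hT⟩
    refine ⟨(uPlus_susp ω).2 ⟨A, B, a, b, c, hA, hB, hT⟩, ?_⟩
    obtain ⟨X2, x2, y2, hT2⟩ := distinguished_cocone_triangle₁ γ
    have hX2 : X2 ∈ ω := cocone_omega hs hadd hT2 hB hG₂ hγ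
    have hG₁' : G₁ ∈ uPlus ω := (uPlus_susp ω).1 hG₁
    obtain ⟨c', hc'⟩ := Triangle.yoneda_exact₂ _ hT2 (c ≫ α⟦(1:ℤ)⟧')
      (U2_shift (uPlus_Good hs hadd hG₁').1 0 1 (omega_Vn hs hX2) (by omega) _)
    change G₂ ⟶ G₁⟦(1:ℤ)⟧ at c'
    change c ≫ α⟦(1:ℤ)⟧' = γ ≫ c' at hc'
    obtain ⟨G, a', b', hT'⟩ := distinguished_cocone_triangle₂ c'
    obtain ⟨β, h1, h2⟩ := complete_distinguished_triangle_morphism₂ _ _ hT hT' α γ hc'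
    exact ⟨G, star_shf (uPlus_iso hadd) (uPlus_susp ω).2 1 ⟨G₁, G₂, a', b', c', hG₁, hG₂, hT'⟩, β,
      Apx_ext hT hT' h1 h2 hc' hα hγ⟩
  · intro W hW
    refine ⟨uPlus_omega ω hW, (0 : C), ?_, 0, ?_, ?_⟩
    · exact ⟨0, uPlus_omega ω (zero_omega hadd _ (isZero_zero C)),
        ⟨((shiftFunctor C (1:ℤ)).mapZeroObject).symm⟩⟩
    · intro k _ P _ g _
      exact (isZero_zero C).eq_of_src _ _
    · intro k hk P hP f
      exact ⟨0, by rw [omega_Vn hs hW k (by omega) P hP f, comp_zero]⟩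

lemma decomp1 {ω : Set C} (hs : silting ω) (hadd : isAdd ω) {Z : C} (hZ : Z ∈ uPlus ω) :
    ∃ (W G : C) (x : W ⟶ Z) (μ : Z ⟶ G) (h : G ⟶ W⟦(1:ℤ)⟧), W ∈ ω ∧ G ∈ shf (uPlus ω) 1 ∧
      Triangle.mk x μ h ∈ distTriang C := by
  obtain ⟨_, G, hG, μ, hμ⟩ := step hs hadd hZ
  obtain ⟨W, x, h, hT⟩ := distinguished_cocone_triangle₁ μ
  exact ⟨W, G, x, μ, h, cocone_omega hs hadd hT hZ hG hμ, hG, hT⟩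

lemma multi {ω : Set C} (hs : silting ω) (hadd : isAdd ω) (n : ℕ) {Z : C} (hZ : Z ∈ uPlus ω) :
    ∃ G ∈ shf (uPlus ω) n, ∃ μ : Z ⟶ G, Apx ω n μ := by
  induction n with
  | zero => exact ⟨Z, by simpa using mem_shf_zero hZ, 𝟙 Z, Apx_iso ω _ (Iso.refl Z)⟩
  | succ n ih =>
    obtain ⟨G, hG, μ, hμ⟩ := ih
    obtain ⟨-, H, hH, ν, hν⟩ := step hs hadd (shf_neg (m := -n) (uPlus_iso hadd) hG (by omega))
    refine ⟨H⟦(n:ℤ)⟧, shf_shift hH _ _ (by push_cast; omega),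
      μ ≫ (unsh (n:ℤ) G).symm.hom ≫ ν⟦(n:ℤ)⟧', ?_⟩
    refine Apx_comp (n := n) (by push_cast; omega) hμ ?_
    refine Apx_comp (n := n) (by push_cast; omega) (Apx_iso ω _ _) ?_
    exact Apx_shift hν _ _ (by push_cast; omega)

lemma Vn_cone {ω : Set C} {n : ℤ} {X Z G : C} {x : X ⟶ Z} {μ : Z ⟶ G} {h : G ⟶ X⟦(1:ℤ)⟧}
    (hT : Triangle.mk x μ h ∈ distTriang C) (hZ : Z ∈ Vn ω n) (hX : X ∈ Vn ω (n - 1)) :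
    G ∈ Vn ω n :=
  Vn_ext ω n ⟨Z, X⟦(1:ℤ)⟧, _, _, _, hZ, Vn_shift hX 1 n (by omega), rot_of_distTriang _ hT⟩

lemma uPlus_bdd {ω : Set C} (hs : silting ω) {Z : C} (hZ : Z ∈ uPlus ω) :
    ∃ N : ℕ, Z ∈ Vn ω N := by
  have : uPlus ω ⊆ {Z | ∃ N : ℕ, Z ∈ Vn ω N} := by
    refine uPlus_min ⟨?_, ?_⟩ ?_
    · rintro Z ⟨A, ⟨N, hA⟩, ⟨e⟩⟩
      exact ⟨N + 1, Vn_iso ω _ (Vn_shift hA 1 _ (by push_cast; rfl)) e.symm⟩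
    · rintro Z ⟨A, B, f, g, h, ⟨N, hA⟩, ⟨M, hB⟩, hT⟩
      exact ⟨N + M, Vn_ext ω _ ⟨A, B, f, g, h, Vn_mono ω (by push_cast; omega) hA,
        Vn_mono ω (by push_cast; omega) hB, hT⟩⟩
    · exact fun W hW => ⟨0, omega_Vn hs hW⟩
  exact this hZ

lemma En {ω : Set C} (hs : silting ω) (hadd : isAdd ω) (n : ℕ) {X : C} (hX : X ∈ uPlus ω)
    (hX' : X ∈ Vn ω n) : X ∈ shf (uMinus ω) n := by
  induction n generalizing X with
  | zero =>
    have := Good_Vn hadd (uPlus_Good hs hadd hX) (by simpa using hX')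
    simpa using mem_shf_zero (uMinus_omega ω this)
  | succ n ih =>
    obtain ⟨W, G, x, μ, h, hW, hG, hT⟩ := decomp1 hs hadd hX
    have hG1 : G ∈ Vn ω (n + 1 : ℕ) :=
      Vn_cone hT hX' (Vn_mono ω (by push_cast; omega) (omega_Vn hs hW))
    have hG2 := ih (shf_neg (m := -1) (uPlus_iso hadd) hG (by omega))
      (Vn_shift hG1 (-1) n (by push_cast; omega))
    have hG3 : G ∈ shf (uMinus ω) (n + 1 : ℕ) := shf_unshift (-1) _ hG2 (by push_cast; omega)
    have hW3 : W ∈ shf (uMinus ω) (n + 1 : ℕ) :=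
      uMinus_shf_le hadd (b := 0) (by omega) (mem_shf_zero (uMinus_omega ω hW))
    exact star_shf (uMinus_iso hadd) (uMinus_susp ω).2 _ ⟨W, G, x, μ, h, hW3, hG3, hT⟩

lemma decomp1' {ω : Set C} (hs : silting ω) (hadd : isAdd ω) {Z : C} (hZ : Z ∈ uPlus ω) :
    ∃ (D W : C) (d : D ⟶ W) (p : W ⟶ Z) (e : Z ⟶ D⟦(1:ℤ)⟧), D ∈ uPlus ω ∧ W ∈ ω ∧
      Triangle.mk d p e ∈ distTriang C := by
  obtain ⟨W, G, x, μ, h, hW, hG, hT⟩ := decomp1 hs hadd hZ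
  exact ⟨G⟦(-1:ℤ)⟧, W, _, _, _, shf_neg (uPlus_iso hadd) hG (by omega), hW,
    inv_rot_of_distTriang _ hT⟩

lemma uPlus_summand_aux {ω : Set C} (hs : silting ω) (hadd : isAdd ω) (N : ℕ) {Z Z' : C}
    (hZ' : Z' ∈ uPlus ω) (i : Z ⟶ Z') (r : Z' ⟶ Z) (hir : i ≫ r = 𝟙 Z) (hZ : Z ∈ Vn ω N) :
    Z ∈ uPlus ω := by
  induction N generalizing Z Z' with
  | zero =>
    exact uPlus_omega ω (Good_Vn hadd (Good_summand ω (uPlus_Good hs hadd hZ') ⟨i, r, hir⟩)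
      (by simpa using hZ))
  | succ N ih =>
    obtain ⟨D, W, d, p, e, hD, hW, hT⟩ := decomp1' hs hadd hZ'
    obtain ⟨DZ, j, eZ, hTZ⟩ := distinguished_cocone_triangle₁ (p ≫ r)
    obtain ⟨t, ht⟩ := Triangle.coyoneda_exact₃ _ hT (p ≫ r ≫ i)
      (U2_shift (uPlus_Good hs hadd hD).1 0 1 (omega_Vn hs hW) (by omega) _)
    change W ⟶ W at t
    change p ≫ r ≫ i = t ≫ p at ht
    obtain ⟨s1, hs1, hs1'⟩ := complete_distinguished_triangle_morphism₁ _ _ hTZ hT t i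
      (by change (p ≫ r) ≫ i = t ≫ p; rw [Category.assoc, ht])
    change DZ ⟶ D at s1
    change j ≫ t = s1 ≫ d at hs1
    change eZ ≫ s1⟦(1:ℤ)⟧' = i ≫ e at hs1'
    obtain ⟨s2, hs2, hs2'⟩ := complete_distinguished_triangle_morphism₁ _ _ hT hTZ (𝟙 W) r
      (by change p ≫ r = 𝟙 W ≫ (p ≫ r); rw [Category.id_comp])
    change D ⟶ DZ at s2
    change d ≫ 𝟙 W = s2 ≫ j at hs2
    change e ≫ s2⟦(1:ℤ)⟧' = r ≫ eZ at hs2'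
    rw [Category.comp_id] at hs2
    obtain ⟨σ, hσ⟩ := Triangle.coyoneda_exact₂ _ hTZ (t - 𝟙 W) (by
      change (t - 𝟙 W) ≫ (p ≫ r) = 0
      rw [Preadditive.sub_comp, ← Category.assoc, ← ht, Category.assoc, Category.assoc, hir]
      simp)
    change W ⟶ DZ at σ
    change t - 𝟙 W = σ ≫ j at hσ
    have z3 : eZ ≫ j⟦(1:ℤ)⟧' = 0 := comp_distTriang_mor_zero₃₁ _ hTZ
    have c1 : j ≫ 𝟙 W = (s1 ≫ s2 - j ≫ σ) ≫ j := by
      rw [Preadditive.sub_comp, Category.assoc, Category.assoc, ← hs2, ← hs1, ← hσ,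
        Preadditive.comp_sub]
      abel
    have c3 : eZ ≫ (s1 ≫ s2 - j ≫ σ)⟦(1:ℤ)⟧' = 𝟙 Z ≫ eZ := by
      rw [Functor.map_sub, Functor.map_comp, Functor.map_comp, Preadditive.comp_sub,
        ← Category.assoc, hs1', ← Category.assoc, z3, zero_comp, sub_zero, Category.assoc, hs2',
        ← Category.assoc, hir]
    let φ : Triangle.mk j (p ≫ r) eZ ⟶ Triangle.mk j (p ≫ r) eZ :=
      { hom₁ := s1 ≫ s2 - j ≫ σ
        hom₂ := 𝟙 W
        hom₃ := 𝟙 Z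
        comm₁ := c1
        comm₂ := (Category.comp_id (p ≫ r)).trans (Category.id_comp (p ≫ r)).symm
        comm₃ := c3 }
    have hiso : IsIso (s1 ≫ s2 - j ≫ σ) :=
      isIso₁_of_isIso₂₃ φ hTZ hTZ (inferInstanceAs (IsIso (𝟙 W))) (inferInstanceAs (IsIso (𝟙 Z)))
    have hDZ1 : DZ⟦(1:ℤ)⟧ ∈ Vn ω (N + 1 : ℕ) :=
      Vn_cone (rot_of_distTriang _ hTZ) hZ (Vn_mono ω (by push_cast; omega) (omega_Vn hs hW))
    have hDZ : DZ ∈ uPlus ω := by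
      refine ih (biprod_mem (uPlus_susp ω).2 hD (uPlus_omega ω hW)) (biprod.lift s1 j)
        (biprod.desc s2 (-σ) ≫ inv (s1 ≫ s2 - j ≫ σ)) ?_
        (Vn_unshift 1 _ hDZ1 (by push_cast; rfl))
      rw [← Category.assoc, biprod.lift_desc, Preadditive.comp_neg, ← sub_eq_add_neg,
        IsIso.hom_inv_id]
    exact (uPlus_susp ω).2 ⟨W, DZ⟦(1:ℤ)⟧, _, _, _, uPlus_omega ω hW,
      (uPlus_susp ω).1 (mem_shf hDZ 1), rot_of_distTriang _ hTZ⟩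

lemma uPlus_summand {ω : Set C} (hs : silting ω) (hadd : isAdd ω) : summandClosed (uPlus ω) := by
  rintro W Z hW ⟨i, r, hir⟩
  obtain ⟨N, hN⟩ := uPlus_bdd hs hW
  exact uPlus_summand_aux hs hadd N hW i r hir (Vn_summand ω N hN ⟨i, r, hir⟩)

lemma star_iso (X Y : Set C) : isoClosed (star X Y) := by
  rintro Z Z' ⟨A, B, f, g, h, hA, hB, hT⟩ e
  refine ⟨A, B, f ≫ e.hom, e.inv ≫ g, h, hA, hB, isomorphic_distinguished _ hT _ ?_⟩
  exact Triangle.isoMk _ _ (Iso.refl _) e.symm (Iso.refl _)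
    (by change (f ≫ e.hom) ≫ e.inv = 𝟙 A ≫ f; simp)
    (by change (e.inv ≫ g) ≫ 𝟙 B = e.inv ≫ g; simp)
    (by change h ≫ (𝟙 A)⟦(1:ℤ)⟧' = 𝟙 B ≫ h; simp)

lemma decompT {ω : Set C} (hs : silting ω) (hadd : isAdd ω) {Z : C} {m : ℤ}
    (hZ : Z ∈ shf (uPlus ω) m) : Z ∈ star (shf (uMinus ω) (-1)) (uPlus ω) := by
  obtain ⟨n, hn⟩ : ∃ n : ℕ, -((n + 1 : ℕ) : ℤ) ≤ m := ⟨m.natAbs, by omega⟩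
  have hZ1 := uPlus_shf_le hadd hn hZ
  have hZ2 : Z⟦((n + 1 : ℕ) : ℤ)⟧ ∈ uPlus ω := shf_neg (uPlus_iso hadd) hZ1 (by omega)
  obtain ⟨G, hG, μ, hμ⟩ := multi hs hadd (n + 1) hZ2
  obtain ⟨X, x, h, hT⟩ := distinguished_cocone_triangle₁ μ
  have hX1 : X ∈ uPlus ω :=
    cocone_mem hadd hT hZ2 (uPlus_shf_le hadd (by push_cast; omega) hG)
  have hX2 : X ∈ shf (uMinus ω) n := by
    refine En hs hadd n hX1 ?_
    have := Apx_cocone hT hμ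
    simpa using this
  obtain ⟨f', g', h', hT'⟩ := tri_shift hT (-((n + 1 : ℕ) : ℤ))
  exact star_iso _ _ ⟨_, _, f', g', h', shf_shift hX2 _ _ (by push_cast; omega),
    shf_neg (uPlus_iso hadd) hG (by omega), hT'⟩ (unsh' _ Z)

lemma thickClosure_thick (ω : Set C) (hadd : isAdd ω) : IsThick (thickClosure ω) where
  zero := ⟨0, fun S hS => hS.2 (zero_omega hadd _ (isZero_zero C)), isZero_zero C⟩
  iso := fun A B hA e S hS => hS.1.iso (hA S hS) e
  shift := by
    rintro n Z ⟨A, hA, e⟩ S hS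
    exact hS.1.shift n ⟨A, hA S hS, e⟩
  ext := by
    rintro Z ⟨A, B, f, g, h, hA, hB, hT⟩ S hS
    exact hS.1.ext ⟨A, B, f, g, h, hA S hS, hB S hS, hT⟩
  summand := fun W Z hW h S hS => hS.1.summand (hW S hS) h

lemma thickClosure_omega (ω : Set C) : ω ⊆ thickClosure ω := fun _ h S hS => hS.2 h

lemma uPlus_thick {ω : Set C} (hadd : isAdd ω) : uPlus ω ⊆ thickClosure ω :=
  uPlus_min ⟨(thickClosure_thick ω hadd).shift 1, (thickClosure_thick ω hadd).ext⟩
    (thickClosure_omega ω)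

lemma uMinus_thick {ω : Set C} (hadd : isAdd ω) : uMinus ω ⊆ thickClosure ω :=
  uMinus_min ⟨(thickClosure_thick ω hadd).shift (-1), (thickClosure_thick ω hadd).ext⟩
    (thickClosure_omega ω)

lemma TT_thick {ω : Set C} (hs : silting ω) (hadd : isAdd ω) :
    IsThick (⋃ n : ℤ, shf (uPlus ω) n) where
  zero := ⟨0, Set.mem_iUnion.2 ⟨0, mem_shf_zero (uPlus_omega ω (zero_omega hadd _ (isZero_zero C)))⟩,
    isZero_zero C⟩
  iso := by
    intro A B hA e
    obtain ⟨n, hn⟩ := Set.mem_iUnion.1 hA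
    exact Set.mem_iUnion.2 ⟨n, shf_iso _ _ hn e⟩
  shift := by
    rintro n Z ⟨A, hA, ⟨e⟩⟩
    obtain ⟨m, hm⟩ := Set.mem_iUnion.1 hA
    exact Set.mem_iUnion.2 ⟨m + n, shf_iso _ _ (shf_shift hm n _ rfl) e.symm⟩
  ext := by
    rintro Z ⟨A, B, f, g, h, hA, hB, hT⟩
    obtain ⟨n, hn⟩ := Set.mem_iUnion.1 hA
    obtain ⟨m, hm⟩ := Set.mem_iUnion.1 hB
    exact Set.mem_iUnion.2 ⟨min n m, star_shf (uPlus_iso hadd) (uPlus_susp ω).2 _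
      ⟨A, B, f, g, h, uPlus_shf_le hadd (min_le_left _ _) hn,
        uPlus_shf_le hadd (min_le_right _ _) hm, hT⟩⟩
  summand := by
    rintro W Z hW ⟨i, r, hir⟩
    obtain ⟨n, hn⟩ := Set.mem_iUnion.1 hW
    refine Set.mem_iUnion.2 ⟨n, shf_of_neg (m := -n) ?_ (by omega)⟩
    refine uPlus_summand hs hadd (shf_neg (m := -n) (uPlus_iso hadd) hn (by omega))
      ⟨i⟦-n⟧', r⟦-n⟧', ?_⟩
    rw [← Functor.map_comp, hir, CategoryTheory.Functor.map_id]

lemma TT_eq {ω : Set C} (hs : silting ω) (hadd : isAdd ω) :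
    (⋃ n : ℤ, shf (uPlus ω) n) = thickClosure ω := by
  apply Set.Subset.antisymm
  · refine Set.iUnion_subset fun n Z hZ => ?_
    exact (thickClosure_thick ω hadd).shift n (shf_mono (uPlus_thick hadd) n hZ)
  · intro Z hZ
    exact hZ _ ⟨TT_thick hs hadd,
      fun W hW => Set.mem_iUnion.2 ⟨0, mem_shf_zero (uPlus_omega ω hW)⟩⟩

lemma decompS {ω : Set C} (hs : silting ω) (hadd : isAdd ω) :
    thickClosure ω = star (shf (uMinus ω) (-1)) (uPlus ω) := by
  apply Set.Subset.antisymm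
  · intro Z hZ
    rw [← TT_eq hs hadd] at hZ
    obtain ⟨m, hm⟩ := Set.mem_iUnion.1 hZ
    exact decompT hs hadd hm
  · rintro Z ⟨A, B, f, g, h, hA, hB, hT⟩
    have h' := thickClosure_thick ω hadd
    exact h'.ext ⟨A, B, f, g, h, h'.shift _ (shf_mono (uMinus_thick hadd) _ hA),
      uPlus_thick hadd hB, hT⟩

lemma Vn_thick {ω : Set C} (hs : silting ω) (hadd : isAdd ω) {Y : C} (hY : Y ∈ Vn ω 0)
    (hY' : Y ∈ thickClosure ω) : Y ∈ uMinus ω := by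
  have h1 : Y⟦(-1:ℤ)⟧ ∈ thickClosure ω := (thickClosure_thick ω hadd).shift (-1) (mem_shf hY' _)
  rw [decompS hs hadd] at h1
  obtain ⟨A, B, f, g, h, hA, hB, hT⟩ := h1
  obtain ⟨f', g', h', hT'⟩ := tri_shift hT 1
  have h2 : Y ∈ star (uMinus ω) (shf (uPlus ω) 1) :=
    star_iso _ _ ⟨_, _, f', g', h', shf_neg (uMinus_iso hadd) hA (by omega), mem_shf hB 1, hT'⟩
      (unsh 1 Y)
  clear hT' h' g' f' hT h g f hA hB A B
  obtain ⟨V, G, f, g, h, hV, hG, hT⟩ := h2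
  have hU1 : G⟦(-1:ℤ)⟧ ∈ uPlus ω := shf_neg (uPlus_iso hadd) hG (by omega)
  have hG1 : G ∈ Vn ω 1 :=
    Vn_cone hT (Vn_mono ω (by omega) hY) (Vn_mono ω (by omega) (uMinus_Vn hs hV))
  have hU : G⟦(-1:ℤ)⟧ ∈ ω := Good_Vn hadd (uPlus_Good hs hadd hU1) (Vn_shift hG1 _ _ (by omega))
  have hg : g = 0 := by
    obtain ⟨D, hD, ⟨e⟩⟩ := hG
    rw [← cancel_mono e.hom, zero_comp]
    exact U2_shift (uPlus_Good hs hadd hD).1 0 1 hY (by omega) _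
  subst hg
  obtain ⟨e, -⟩ := exists_iso_binaryBiproduct_of_distTriang _ (inv_rot_of_distTriang _ hT)
    (by change (0 : Y ⟶ G) ≫ _ = 0; exact zero_comp)
  change V ≅ (G⟦(-1:ℤ)⟧) ⊞ Y at e
  have hYU : (Y ⊞ G⟦(-1:ℤ)⟧) ∈ uMinus ω := uMinus_iso hadd hV (e ≪≫ biprod.braiding _ _)
  exact (uMinus_susp ω).2 ⟨_, _, _, _, _, (uMinus_susp ω).1 (mem_shf (uMinus_omega ω hU) (-1)), hYU,
    inv_rot_of_distTriang _ (binaryBiproductTriangle_distinguished Y (G⟦(-1:ℤ)⟧))⟩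

lemma uMinus_summand {ω : Set C} (hs : silting ω) (hadd : isAdd ω) : summandClosed (uMinus ω) :=
  fun _ _ hW h => Vn_thick hs hadd (Vn_summand ω 0 (uMinus_Vn hs hW) h)
    ((thickClosure_thick ω hadd).summand (uMinus_thick hadd hW) h)

lemma union_minus {ω : Set C} (hs : silting ω) (hadd : isAdd ω) :
    (⋃ n : ℤ, shf (uMinus ω) n) = thickClosure ω := by
  apply Set.Subset.antisymm
  · refine Set.iUnion_subset fun n Z hZ => ?_
    exact (thickClosure_thick ω hadd).shift n (shf_mono (uMinus_thick hadd) n hZ)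
  · intro Z hZ
    have hZ' := hZ
    rw [← TT_eq hs hadd] at hZ'
    obtain ⟨m, hm⟩ := Set.mem_iUnion.1 hZ'
    obtain ⟨N, hN⟩ := uPlus_bdd hs (shf_neg (m := -m) (uPlus_iso hadd) hm (by omega))
    have h1 : Z ∈ Vn ω (N + m) := Vn_unshift (-m) _ hN (by omega)
    refine Set.mem_iUnion.2 ⟨N + m, shf_of_neg (m := -(N + m)) ?_ (by omega)⟩
    exact Vn_thick hs hadd (Vn_shift h1 _ _ (by omega))
      ((thickClosure_thick ω hadd).shift _ (mem_shf hZ _))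

lemma main11 (ω : Set C) (hs : silting ω) (hadd : isAdd ω) :
    ω = uMinus ω ∩ uPlus ω ∧
    IsCotStructure (thickClosure ω) (uMinus ω) (uPlus ω) ∧
    (⋃ n : ℤ, shf (uMinus ω) n) = thickClosure ω ∧
    (⋃ n : ℤ, shf (uPlus ω) n) = thickClosure ω := by
  refine ⟨inter_eq hs hadd, ?_, union_minus hs hadd, TT_eq hs hadd⟩
  exact {
    subA := uMinus_thick hadd
    subB := uPlus_thick hadd
    isoA := uMinus_iso hadd
    isoB := uPlus_iso hadd
    addA := addClosed_of_star (fun Z hZ => uMinus_omega ω (zero_omega hadd Z hZ)) (uMinus_susp ω).2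
    addB := addClosed_of_star (fun Z hZ => uPlus_omega ω (zero_omega hadd Z hZ)) (uPlus_susp ω).2
    summandA := uMinus_summand hs hadd
    summandB := uPlus_summand hs hadd
    shiftA := (uMinus_susp ω).1
    shiftB := (uPlus_susp ω).1
    orth := fun A hA B hB f => (uPlus_Good hs hadd hB).1 A
      (Vn_shf (-1) (-1) (by omega) (shf_mono (uMinus_Vn hs) _ hA)) f
    decomp := decompS hs hadd }

/-- Let `ω` be a silting class in `T` with `ω = add ω`. Then
`ω = _ωU ∩ U_ω` and the pair `(_ωU, U_ω)` is a bounded co-t-structure on `Δ̄_T(ω)`. -/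
theorem stmt11 (ω : Set C) (hs : silting ω) (hadd : isAdd ω) :
    ω = uMinus ω ∩ uPlus ω ∧
    IsCotStructure (thickClosure ω) (uMinus ω) (uPlus ω) ∧
    (⋃ n : ℤ, shf (uMinus ω) n) = thickClosure ω ∧
    (⋃ n : ℤ, shf (uPlus ω) n) = thickClosure ω := by
  exact main11 ω hs hadd

end CotPaper
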